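/- Let n ≥ 1, b ∈ ℝ, F ∈ C¹, and let x = (x₁, …, x_n) : [0,∞) → ℝ^n be a solution of the integrator chain ẋ_i = x_{i+1} (i = 1, …, n−1), ẋ_n = F(t, x(t), w(t)) + b u(t), with output y = x₁, where w : [0,∞) → ℝ^{n_d} is C¹ with sup_t ‖(w(t), ẇ(t))‖ < ∞, there exists a continuous function χ such that ‖F(t, x, w)‖ ≤ χ(x, w) and ‖∇F(t, x, w)‖ ≤ χ(x, w) for all t, and u is a bounded function with sup_t (‖x(t)‖₂ + |u(t)|) < ∞. Let π_{θ_1}, …, π_{θ_{n+1}} be residual feed-forward neural networks with scalar input and scalar output, activation σ, σ(0) = 0, sector bounded at every neuron; for ε > 0 consider the observer x̂_i′ = x̂_{i+1} + ε^{n−i} π_{θ_i}(ε^{−n}(y − x̂₁)) for i = 1, …, n−1, x̂_n′ = x̂_{n+1} + π_{θ_n}(ε^{−n}(y − x̂₁)) + b u, x̂_{n+1}′ = ε^{−1} π_{θ_{n+1}}(ε^{−n}(y − x̂₁)), with fixed, ε-independent initial values x̂_i(0). Let Ã ∈ ℝ^{(n+1)×(n+1)} be the upper shift matrix (entries Ã_{i,i+1}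 = 1 and all others 0) and c̃ = [1, 0, …, 0] ∈ ℝ^{1×(n+1)}. Form the K = n+1 stacked isolation matrices R̂_π, R̂_ξ of the network vector (π_{θ_1}, …, π_{θ_{n+1}}) with T_k¹ = c̃ and T_k² = 1 for all k, and Ψ(n+1), M(n+1)(λ) for some λ ≥ 0. Assume there exists a symmetric positive definite P ∈ ℝ^{(n+1)×(n+1)} such that R̂_πᵀ [[ÃᵀP + PÃ, −P], [−P, 0]] R̂_π + R̂_ξᵀ Ψ(n+1)ᵀ M(n+1)(λ) Ψ(n+1) R̂_ξ is negative definite. Then for every T > 0 and δ > 0 there exists ε₀ > 0 such that for all ε ∈ (0, ε₀) and every solution x̂^ε = (x̂₁^ε, …, x̂_{n+1}^ε) of the observer with the given initial values, ‖(x₁(t), …, x_n(t)) − (x̂₁^ε(t), …, x̂_n^ε(t))‖₂ ≤ δ for all t ≥ T. -/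

import Mathlib

open Matrix

/-- A residual feed-forward neural network with `Lm + 1` hidden layers,
input dimension `n₀`, output dimension `m`.  `hw l` is the width of hidden layer `l+1`
(0-based: hidden layers are indexed `0, …, Lm`).  `W l` is the weight matrix feeding
hidden layer `l`, `Wout` the output weight matrix `W^{L+1}` and `Wskip` the shortcut
connection weight matrix `W^{L+2}`. -/
structure ResNet (n₀ m : ℕ) where
  Lm : ℕ
  hw : ℕ → ℕ
  W : (l : ℕ) → Matrix (Fin (hw l)) (Fin (if l = 0 then n₀ else hw (l - 1))) ℝ
  Wout : Matrix (Fin m) (Fin (hw Lm)) ℝ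
  Wskip : Matrix (Fin m) (Fin n₀) ℝ

namespace ResNet

variable {n₀ m : ℕ}

/-- dimension of layer `l` (`l = 0` is the input layer, `l = 1, …, Lm+1` the hidden layers). -/
def dim (net : ResNet n₀ m) (l : ℕ) : ℕ := if l = 0 then n₀ else net.hw (l - 1)

/-- the forward pass through the hidden layers: `hfun σ net l x` is `h^l(x)`. -/
def hfun (σ : ℝ → ℝ) (net : ResNet n₀ m) : (l : ℕ) → (Fin n₀ → ℝ) → (Fin (net.dim l) → ℝ)
  | 0, x => x
  | l + 1, x => fun i => σ ((net.W l).mulVec (hfun σ net l x) i)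

/-- the output `π(x) = W^{L+1} h^L(x) + W^{L+2} x` of the residual network. -/
def apply (σ : ℝ → ℝ) (net : ResNet n₀ m) (x : Fin n₀ → ℝ) : Fin m → ℝ :=
  net.Wout.mulVec (hfun σ net (net.Lm + 1) x) + net.Wskip.mulVec x

/-- index type for the neurons (all hidden layers stacked). -/
abbrev NIdx (net : ResNet n₀ m) : Type := Σ l : Fin (net.Lm + 1), Fin (net.hw l)

/-- the first-layer weight matrix `W^1`. -/
def W1 (net : ResNet n₀ m) : Matrix (Fin (net.hw 0)) (Fin n₀) ℝ := net.W 0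

/-- the isolation block `N_{πw} = [0 ⋯ 0 W^{L+1}]`. -/
def Npiw (net : ResNet n₀ m) : Matrix (Fin m) net.NIdx ℝ :=
  Matrix.of fun i j =>
    if h : (j.1 : ℕ) = net.Lm then net.Wout i (Fin.cast (congrArg net.hw h) j.2) else 0

/-- the isolation block `N_{ξx} = [(W^1 T)ᵀ 0 ⋯ 0]ᵀ` for an input pre-matrix `T`. -/
def Nxix (net : ResNet n₀ m) {P : Type*} (T : Matrix (Fin n₀) P ℝ) :
    Matrix net.NIdx P ℝ :=
  Matrix.of fun j i =>
    if h : (j.1 : ℕ) = 0 then (net.W1 * T) (Fin.cast (congrArg net.hw h) j.2) i else 0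

/-- the isolation block `N_{ξw}` (block `(l, l-1)` is `W^l`). -/
def Nxiw (net : ResNet n₀ m) : Matrix net.NIdx net.NIdx ℝ :=
  Matrix.of fun i j =>
    if h : (j.1 : ℕ) + 1 = (i.1 : ℕ) then
      net.W i.1 i.2 (Fin.cast (by
        rw [if_neg (by omega : ¬ ((i.1 : ℕ)) = 0)]
        exact congrArg net.hw (by omega)) j.2)
    else 0

/-- the isolation matrix `R_π = [[I, 0], [N_{πx}, N_{πw}]]` with input pre-matrix `T`. -/
def Rpi (net : ResNet n₀ m) {P : Type*} [DecidableEq P]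
    (T : Matrix (Fin n₀) P ℝ) : Matrix (P ⊕ Fin m) (P ⊕ net.NIdx) ℝ :=
  Matrix.fromBlocks 1 0 (net.Wskip * T) net.Npiw

/-- the isolation matrix `R_ξ = [[N_{ξx}, N_{ξw}], [0, I]]` with input pre-matrix `T`. -/
def Rxi (net : ResNet n₀ m) {P : Type*}
    (T : Matrix (Fin n₀) P ℝ) : Matrix (net.NIdx ⊕ net.NIdx) (P ⊕ net.NIdx) ℝ :=
  Matrix.fromBlocks (net.Nxix T) net.Nxiw 0 1

end ResNet

/-- `Ψ = [[diag β, -I], [-diag α, I]]`. -/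
def Psi {I : Type*} [DecidableEq I] (a b : I → ℝ) : Matrix (I ⊕ I) (I ⊕ I) ℝ :=
  Matrix.fromBlocks (Matrix.diagonal b) (-1) (-(Matrix.diagonal a)) 1

/-- `M(λ) = [[0, diag λ], [diag λ, 0]]`. -/
def Mmat {I : Type*} [DecidableEq I] (lam : I → ℝ) : Matrix (I ⊕ I) (I ⊕ I) ℝ :=
  Matrix.fromBlocks 0 (Matrix.diagonal lam) (Matrix.diagonal lam) 0

/-- a matrix is negative definite if its quadratic form is negative on nonzero vectors. -/
def Matrix.NegDef {I : Type*} [Fintype I] (S : Matrix I I ℝ) : Prop :=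
  ∀ x : I → ℝ, x ≠ 0 → x ⬝ᵥ S.mulVec x < 0

/-- the Euclidean norm `‖v‖₂` of a finitely indexed real vector. -/
noncomputable def norm2 {I : Type*} [Fintype I] (v : I → ℝ) : ℝ := Real.sqrt (∑ i, v i ^ 2)

/-- `σ` is sector bounded in `[a, b]`. -/
def SectorBounded (σ : ℝ → ℝ) (a b : ℝ) : Prop := ∀ s : ℝ, 0 ≤ (σ s - a * s) * (b * s - σ s)

/-- `(C, A)` is an observable pair. -/
def Observable {n p : Type*} [Fintype n] [DecidableEq n]
    (C : Matrix p n ℝ) (A : Matrix n n ℝ) : Prop :=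
  ∀ x : n → ℝ, (∀ k : ℕ, (C * A ^ k).mulVec x = 0) → x = 0

/-- a real square matrix is Hurwitz if all its complex eigenvalues have negative real part. -/
def IsHurwitz {n : ℕ} (A : Matrix (Fin n) (Fin n) ℝ) : Prop :=
  ∀ μ ∈ spectrum ℂ (A.map (Complex.ofReal)), μ.re < 0

/-- induced `∞`-norm of a matrix: maximum absolute row sum. -/
noncomputable def rowSumNorm {I J : Type*} [Fintype J] (A : Matrix I J ℝ) : ℝ :=
  ⨆ i, ∑ j, |A i j|

section StackScalar

variable {n : ℕ}

/-- stacked block `N̂_{πx}` for `n+1` scalar-input scalar-output networks with common input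
pre-matrix `ct` (each `T_k² = 1`). -/
def NpixS (nets : Fin (n + 1) → ResNet 1 1) (ct : Matrix (Fin 1) (Fin (n + 1)) ℝ) :
    Matrix (Fin (n + 1)) (Fin (n + 1)) ℝ :=
  Matrix.of fun i j => ((nets i).Wskip * ct) 0 j

/-- stacked block `N̂_{πw}` for `n+1` scalar-input scalar-output networks. -/
def NpiwS (nets : Fin (n + 1) → ResNet 1 1) :
    Matrix (Fin (n + 1)) (Σ k, (nets k).NIdx) ℝ :=
  Matrix.of fun i j =>
    if h : j.1 = i then
      (nets i).Npiw 0 (cast (congrArg (fun k => (nets k).NIdx) h) j.2)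
    else 0

/-- stacked block `N̂_{ξx}` for `n+1` scalar-input scalar-output networks. -/
def NxixS (nets : Fin (n + 1) → ResNet 1 1) (ct : Matrix (Fin 1) (Fin (n + 1)) ℝ) :
    Matrix (Σ k, (nets k).NIdx) (Fin (n + 1)) ℝ :=
  Matrix.of fun j i => ((nets j.1).Nxix ct) j.2 i

/-- stacked block `N̂_{ξw}` for `n+1` scalar-input scalar-output networks. -/
def NxiwS (nets : Fin (n + 1) → ResNet 1 1) :
    Matrix (Σ k, (nets k).NIdx) (Σ k, (nets k).NIdx) ℝ :=
  Matrix.of fun i j =>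
    if h : j.1 = i.1 then
      (nets i.1).Nxiw i.2 (cast (congrArg (fun k => (nets k).NIdx) h) j.2)
    else 0

/-- stacked isolation matrix `R̂_π` for `n+1` scalar networks. -/
def RpiS (nets : Fin (n + 1) → ResNet 1 1) (ct : Matrix (Fin 1) (Fin (n + 1)) ℝ) :
    Matrix (Fin (n + 1) ⊕ Fin (n + 1)) (Fin (n + 1) ⊕ Σ k, (nets k).NIdx) ℝ :=
  Matrix.fromBlocks 1 0 (NpixS nets ct) (NpiwS nets)

/-- stacked isolation matrix `R̂_ξ` for `n+1` scalar networks. -/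
def RxiS (nets : Fin (n + 1) → ResNet 1 1) (ct : Matrix (Fin 1) (Fin (n + 1)) ℝ) :
    Matrix ((Σ k, (nets k).NIdx) ⊕ (Σ k, (nets k).NIdx)) (Fin (n + 1) ⊕ Σ k, (nets k).NIdx) ℝ :=
  Matrix.fromBlocks (NxixS nets ct) (NxiwS nets) 0 1

/-- the `(n+1) × (n+1)` upper shift matrix `Ã`. -/
def shiftMat (n : ℕ) : Matrix (Fin (n + 1)) (Fin (n + 1)) ℝ :=
  Matrix.of fun i j => if (i : ℕ) + 1 = (j : ℕ) then 1 else 0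

/-- the row vector `c̃ = [1, 0, …, 0]`. -/
def ctilde (n : ℕ) : Matrix (Fin 1) (Fin (n + 1)) ℝ :=
  Matrix.of fun _ j => if j = 0 then 1 else 0

end StackScalar

theorem aux_gronwall (V V' : ℝ → ℝ) (k C : ℝ) (hk : 0 < k) (hC : 0 ≤ C)
    (hV : ∀ t, 0 ≤ t → HasDerivAt V (V' t) t)
    (hle : ∀ t, 0 ≤ t → V' t ≤ -k * V t + C) (t : ℝ) (ht : 0 ≤ t) :
    V t ≤ Real.exp (-(k * t)) * V 0 + C / k := by
  have hd : ∀ s, 0 ≤ s → HasDerivAt (fun s => Real.exp (k * s) * (V s - C / k))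
      (Real.exp (k * s) * (k * 1) * (V s - C / k) + Real.exp (k * s) * V' s) s := by
    intro s hs
    exact (((hasDerivAt_id' s).const_mul k).exp).mul ((hV s hs).sub_const _)
  have hanti : AntitoneOn (fun s => Real.exp (k * s) * (V s - C / k)) (Set.Ici 0) := by
    apply antitoneOn_of_deriv_nonpos (convex_Ici 0)
    · intro s hs
      exact (hd s hs).continuousAt.continuousWithinAt
    · intro s hs
      rw [interior_Ici] at hs
      exact (hd s (le_of_lt hs)).differentiableAt.differentiableWithinAt
    · intro s hs
      rw [interior_Ici] at hs
      have hs' : 0 ≤ s := le_of_lt hs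
      rw [(hd s hs').deriv]
      have h1 := hle s hs'
      have h2 : Real.exp (k * s) * (k * 1) * (V s - C / k) + Real.exp (k * s) * V' s
          = Real.exp (k * s) * (k * V s - C + V' s) := by
        field_simp
      rw [h2]
      exact mul_nonpos_of_nonneg_of_nonpos (Real.exp_pos _).le (by linarith)
  have h := hanti (Set.mem_Ici.2 le_rfl) (Set.mem_Ici.2 ht) ht
  simp only [mul_zero, Real.exp_zero, one_mul] at h
  have he : Real.exp (-(k * t)) * Real.exp (k * t) = 1 := by
    rw [← Real.exp_add]; simp
  have h3 := mul_le_mul_of_nonneg_left h (Real.exp_pos (-(k * t))).le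
  rw [← mul_assoc, he, one_mul] at h3
  have : 0 ≤ Real.exp (-(k * t)) * (C / k) := by positivity
  nlinarith

theorem aux_quad {I : Type*} [Fintype I] (S : Matrix I I ℝ) :
    ∃ C : ℝ, (Matrix.NegDef S → C < 0) ∧ ∀ x : I → ℝ, x ⬝ᵥ S.mulVec x ≤ C * (x ⬝ᵥ x) := by
  rcases isEmpty_or_nonempty I with hI | hI
  · refine ⟨-1, fun _ => by norm_num, fun x => by simp [dotProduct]⟩
  have hcl : IsClosed {x : I → ℝ | x ⬝ᵥ x = 1} := by
    apply isClosed_eq _ continuous_const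
    unfold dotProduct; fun_prop
  have hcpt : IsCompact {x : I → ℝ | x ⬝ᵥ x = 1} := by
    apply (isCompact_closedBall (0 : I → ℝ) 1).of_isClosed_subset hcl
    intro x hx
    rw [mem_closedBall_zero_iff, pi_norm_le_iff_of_nonneg zero_le_one]
    intro i
    rw [Real.norm_eq_abs]
    have h1 : x i * x i ≤ x ⬝ᵥ x :=
      Finset.single_le_sum (f := fun i => x i * x i)
        (fun j _ => mul_self_nonneg (x j)) (Finset.mem_univ i)
    rw [Set.mem_ofPred_eq.mp hx] at h1
    exact abs_le_one_iff_mul_self_le_one.2 h1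
  have hne : {x : I → ℝ | x ⬝ᵥ x = 1}.Nonempty := by
    classical
    obtain ⟨i⟩ := hI
    exact ⟨Pi.single i 1, by simp⟩
  have hcont : Continuous (fun x : I → ℝ => x ⬝ᵥ S.mulVec x) := by
    unfold Matrix.mulVec dotProduct; fun_prop
  obtain ⟨x0, hx0, hmax⟩ := hcpt.exists_isMaxOn hne hcont.continuousOn
  refine ⟨x0 ⬝ᵥ S.mulVec x0, fun h => h x0 ?_, ?_⟩
  · rintro rfl
    simp at hx0
  · intro x
    by_cases hx : x = 0
    · subst hx; simp
    have hpos : 0 < x ⬝ᵥ x := by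
      have h0 : 0 ≤ x ⬝ᵥ x := Finset.sum_nonneg fun i _ => mul_self_nonneg (x i)
      exact lt_of_le_of_ne h0 fun h => hx (dotProduct_self_eq_zero.1 h.symm)
    set r := Real.sqrt (x ⬝ᵥ x) with hr
    have hr0 : 0 < r := Real.sqrt_pos.2 hpos
    have hrr : r * r = x ⬝ᵥ x := Real.mul_self_sqrt hpos.le
    have h1 : (r⁻¹ • x) ∈ {x : I → ℝ | x ⬝ᵥ x = 1} := by
      simp only [Set.mem_ofPred_eq, smul_dotProduct, dotProduct_smul, smul_eq_mul, ← hrr]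
      field_simp
    have h2 := hmax h1
    simp only [Set.mem_ofPred_eq, Matrix.mulVec_smul, smul_dotProduct, dotProduct_smul,
      smul_eq_mul] at h2
    have h3 := mul_le_mul_of_nonneg_left h2 hpos.le
    rw [← hrr] at h3 ⊢
    have h4 : r * r * (r⁻¹ * (r⁻¹ * (x ⬝ᵥ S.mulVec x))) = x ⬝ᵥ S.mulVec x := by
      field_simp
    linarith

theorem aux_Npiw (σ : ℝ → ℝ) (net : ResNet 1 1) (x : Fin 1 → ℝ) (i : Fin 1) :
    net.Npiw.mulVec (fun j => ResNet.hfun σ net ((j.1 : ℕ) + 1) x j.2) i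
      = net.Wout.mulVec (ResNet.hfun σ net (net.Lm + 1) x) i := by
  unfold Matrix.mulVec dotProduct
  rw [Fintype.sum_sigma, Finset.sum_eq_single (Fin.last net.Lm)]
  · apply Finset.sum_congr rfl
    intro j _
    simp [ResNet.Npiw]
  · intro l _ hl
    apply Finset.sum_eq_zero
    intro j _
    have : ¬ ((l : ℕ) = net.Lm) := fun h => hl (Fin.ext h)
    simp [ResNet.Npiw, this]
  · simp

theorem aux_Nxi (σ : ℝ → ℝ) (net : ResNet 1 1) {Q : Type*} [Fintype Q] (T : Matrix (Fin 1) Q ℝ)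
    (η : Q → ℝ) (i : net.NIdx) :
    (net.Nxix T).mulVec η i +
    net.Nxiw.mulVec (fun j => ResNet.hfun σ net ((j.1 : ℕ) + 1) (T.mulVec η) j.2) i
      = (net.W i.1).mulVec (ResNet.hfun σ net i.1 (T.mulVec η)) i.2 := by
  obtain ⟨⟨l, hl⟩, i⟩ := i
  cases l with
  | zero =>
    have h1 : (net.Nxiw.mulVec (fun j => ResNet.hfun σ net ((j.1 : ℕ) + 1) (T.mulVec η) j.2)
        ⟨⟨0, hl⟩, i⟩) = 0 := by
      simp [Matrix.mulVec, dotProduct, ResNet.Nxiw]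
    rw [h1, add_zero]
    have h2 : (net.Nxix T).mulVec η ⟨⟨0, hl⟩, i⟩ = (net.W1 * T).mulVec η i := by
      simp [Matrix.mulVec, dotProduct, ResNet.Nxix]
    rw [h2, ← Matrix.mulVec_mulVec]
    rfl
  | succ l =>
    have h1 : (net.Nxix T).mulVec η ⟨⟨l+1, hl⟩, i⟩ = 0 := by
      simp [Matrix.mulVec, dotProduct, ResNet.Nxix]
    rw [h1, zero_add]
    unfold Matrix.mulVec dotProduct
    rw [Fintype.sum_sigma, Finset.sum_eq_single (⟨l, by omega⟩ : Fin (net.Lm + 1))]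
    · apply Finset.sum_congr rfl
      intro j _
      simp [ResNet.Nxiw]
    · intro l' _ hl'
      apply Finset.sum_eq_zero
      intro j _
      have : ¬ ((l' : ℕ) = l) := fun h => hl' (Fin.ext h)
      simp [ResNet.Nxiw, this]
    · simp

theorem aux_NpiS (σ : ℝ → ℝ) {n : ℕ} (nets : Fin (n + 1) → ResNet 1 1) (x : Fin 1 → ℝ)
    (i : Fin (n + 1)) :
    (NpiwS nets).mulVec (fun j => ResNet.hfun σ (nets j.1) ((j.2.1 : ℕ) + 1) x j.2.2) i
      = (nets i).Wout.mulVec (ResNet.hfun σ (nets i) ((nets i).Lm + 1) x) 0 := by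
  rw [← aux_Npiw]
  unfold Matrix.mulVec dotProduct
  rw [Fintype.sum_sigma, Finset.sum_eq_single i]
  · apply Finset.sum_congr rfl
    intro j _
    simp [NpiwS]
  · intro k _ hk
    apply Finset.sum_eq_zero
    intro j _
    simp [NpiwS, hk]
  · simp

theorem aux_NxiS (σ : ℝ → ℝ) {n : ℕ} (nets : Fin (n + 1) → ResNet 1 1) (x : Fin 1 → ℝ)
    (i : Σ k, (nets k).NIdx) :
    (NxiwS nets).mulVec (fun j => ResNet.hfun σ (nets j.1) ((j.2.1 : ℕ) + 1) x j.2.2) i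
      = ((nets i.1).Nxiw).mulVec
        (fun j => ResNet.hfun σ (nets i.1) ((j.1 : ℕ) + 1) x j.2) i.2 := by
  obtain ⟨k, i⟩ := i
  unfold Matrix.mulVec dotProduct
  rw [Fintype.sum_sigma, Finset.sum_eq_single k]
  · apply Finset.sum_congr rfl
    intro j _
    simp [NxiwS]
  · intro k' _ hk
    apply Finset.sum_eq_zero
    intro j _
    simp [NxiwS, hk]
  · simp

theorem aux_tr {I J : Type*} [Fintype I] [Fintype J] (A : Matrix I J ℝ) (x : J → ℝ) (y : I → ℝ) :
    x ⬝ᵥ (Aᵀ).mulVec y = (A.mulVec x) ⬝ᵥ y := by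
  rw [dotProduct_mulVec, vecMul_transpose]

theorem aux_ct (n : ℕ) (η : Fin (n + 1) → ℝ) : (ctilde n).mulVec η = fun _ => η 0 := by
  ext i
  simp [ctilde, Matrix.mulVec, dotProduct]

theorem aux_LMI {n : ℕ} {σ : ℝ → ℝ} (nets : Fin (n + 1) → ResNet 1 1)
    (α β lam : (Σ k, (nets k).NIdx) → ℝ)
    (hsec : ∀ i, SectorBounded σ (α i) (β i))
    (hlam : ∀ i, 0 ≤ lam i)
    (P : Matrix (Fin (n + 1)) (Fin (n + 1)) ℝ)
    (hLMI : Matrix.NegDef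
      ((RpiS nets (ctilde n))ᵀ
          * Matrix.fromBlocks ((shiftMat n)ᵀ * P + P * shiftMat n) (-P) (-P) 0
          * RpiS nets (ctilde n)
        + (RxiS nets (ctilde n))ᵀ * (Psi α β)ᵀ * Mmat lam * Psi α β
          * RxiS nets (ctilde n))) :
    ∃ c : ℝ, 0 < c ∧ ∀ η : Fin (n + 1) → ℝ,
      η ⬝ᵥ ((shiftMat n)ᵀ * P + P * shiftMat n).mulVec η
        - η ⬝ᵥ P.mulVec (fun i => (nets i).apply σ (fun _ => η 0) 0)
        - (fun i => (nets i).apply σ (fun _ => η 0) 0) ⬝ᵥ P.mulVec η ≤ - c * (η ⬝ᵥ η) := by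
  obtain ⟨C, hC, hq⟩ := aux_quad ((RpiS nets (ctilde n))ᵀ
          * Matrix.fromBlocks ((shiftMat n)ᵀ * P + P * shiftMat n) (-P) (-P) 0
          * RpiS nets (ctilde n)
        + (RxiS nets (ctilde n))ᵀ * (Psi α β)ᵀ * Mmat lam * Psi α β
          * RxiS nets (ctilde n))
  have hC0 := hC hLMI
  refine ⟨-C, by linarith, fun η => ?_⟩
  set wv : (Σ k, (nets k).NIdx) → ℝ :=
    fun j => ResNet.hfun σ (nets j.1) ((j.2.1 : ℕ) + 1) (fun _ => η 0) j.2.2 with hwv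
  set xi : (Σ k, (nets k).NIdx) → ℝ :=
    fun j => ((nets j.1).W j.2.1).mulVec
      (ResNet.hfun σ (nets j.1) j.2.1 (fun _ => η 0)) j.2.2 with hxi
  set pv : Fin (n + 1) → ℝ := fun i => (nets i).apply σ (fun _ => η 0) 0 with hpv
  have hwx : ∀ j, wv j = σ (xi j) := fun j => rfl
  have h1 : (RpiS nets (ctilde n)).mulVec (Sum.elim η wv) = Sum.elim η pv := by
    rw [RpiS, Matrix.fromBlocks_mulVec]
    congr 1
    · simp
    · ext i
      simp only [Sum.elim_comp_inl, Sum.elim_comp_inr, Pi.add_apply, hwv]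
      rw [aux_NpiS, hpv]
      simp only [ResNet.apply, Pi.add_apply]
      rw [add_comm]
      congr 1
      have : (NpixS nets (ctilde n)).mulVec η i
          = ((nets i).Wskip * ctilde n).mulVec η 0 := rfl
      rw [this, ← Matrix.mulVec_mulVec, aux_ct]
  have h2 : (RxiS nets (ctilde n)).mulVec (Sum.elim η wv) = Sum.elim xi wv := by
    rw [RxiS, Matrix.fromBlocks_mulVec]
    congr 1
    · ext i
      simp only [Sum.elim_comp_inl, Sum.elim_comp_inr, Pi.add_apply, hwv]
      rw [aux_NxiS, hxi]
      have h := aux_Nxi σ (nets i.1) (ctilde n) η i.2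
      rw [aux_ct] at h
      exact h
    · simp
  have h3 : (Psi α β).mulVec (Sum.elim xi wv)
      = Sum.elim (fun j => β j * xi j - wv j) (fun j => wv j - α j * xi j) := by
    rw [Psi, Matrix.fromBlocks_mulVec]
    congr 1
    · ext i
      simp [Matrix.mulVec_diagonal, Matrix.neg_mulVec, sub_eq_add_neg]
    · ext i
      simp [Matrix.mulVec_diagonal, Matrix.neg_mulVec]
      ring
  have h4 := hq (Sum.elim η wv)
  rw [Matrix.add_mulVec, dotProduct_add] at h4
  simp only [← Matrix.mulVec_mulVec] at h4
  rw [h1, h2, h3] at h4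
  rw [aux_tr, aux_tr, aux_tr, h1, h2, h3, Mmat] at h4
  rw [Matrix.fromBlocks_mulVec, Matrix.fromBlocks_mulVec] at h4
  simp only [Sum.elim_comp_inl, Sum.elim_comp_inr, sumElim_dotProduct_sumElim, 
    Matrix.zero_mulVec, zero_add, add_zero, dotProduct_add, Matrix.neg_mulVec,
    dotProduct_neg] at h4
  have h5 : 0 ≤ (fun j => β j * xi j - wv j) ⬝ᵥ
      (Matrix.diagonal lam).mulVec (fun j => wv j - α j * xi j) := by
    apply Finset.sum_nonneg
    intro j _
    rw [Matrix.mulVec_diagonal]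
    have := hsec j (xi j)
    rw [← hwx] at this
    have := mul_nonneg (hlam j) this
    nlinarith
  have h6 : 0 ≤ (fun j => wv j - α j * xi j) ⬝ᵥ
      (Matrix.diagonal lam).mulVec (fun j => β j * xi j - wv j) := by
    apply Finset.sum_nonneg
    intro j _
    rw [Matrix.mulVec_diagonal]
    have := hsec j (xi j)
    rw [← hwx] at this
    have := mul_nonneg (hlam j) this
    nlinarith
  have h7 : 0 ≤ wv ⬝ᵥ wv := Finset.sum_nonneg fun i _ => mul_self_nonneg (wv i)
  have h8 : C * (wv ⬝ᵥ wv) ≤ 0 := mul_nonpos_of_nonpos_of_nonneg hC0.le h7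
  nlinarith

theorem aux_Fdot {n nd : ℕ} (b : ℝ)
    (F : ℝ × (Fin n → ℝ) × (Fin nd → ℝ) → ℝ) (hF : ContDiff ℝ 1 F)
    (χ : (Fin n → ℝ) × (Fin nd → ℝ) → ℝ) (hχ : Continuous χ)
    (hFbd : ∀ (t : ℝ) (xv : Fin n → ℝ) (wv : Fin nd → ℝ),
      |F (t, xv, wv)| ≤ χ (xv, wv) ∧ ‖fderiv ℝ F (t, xv, wv)‖ ≤ χ (xv, wv))
    (w : ℝ → Fin nd → ℝ) (hw : ContDiff ℝ 1 w)
    (Mw : ℝ) (hMw : ∀ t : ℝ, 0 ≤ t → norm2 (w t) + norm2 (deriv w t) ≤ Mw)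
    (u : ℝ → ℝ) (x : ℝ → Fin n → ℝ)
    (hx : ∀ t : ℝ, 0 ≤ t → ∀ i : Fin n, HasDerivAt (fun s => x s i)
      (if h : (i : ℕ) + 1 < n then x t ⟨(i : ℕ) + 1, h⟩ else F (t, x t, w t) + b * u t) t)
    (Mu : ℝ) (hMu : ∀ t : ℝ, 0 ≤ t → norm2 (x t) + |u t| ≤ Mu) :
    ∃ (K : ℝ) (D : ℝ → ℝ), ∀ t, 0 ≤ t →
      HasDerivAt (fun s => F (s, x s, w s)) (D t) t ∧ |D t| ≤ K := by
  have hn2 : ∀ {m : ℕ} (v : Fin m → ℝ), ‖v‖ ≤ norm2 v := by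
    intro m v
    unfold norm2
    rw [pi_norm_le_iff_of_nonneg (Real.sqrt_nonneg _)]
    intro i
    apply Real.abs_le_sqrt
    exact Finset.single_le_sum (f := fun i => v i ^ 2) (fun j _ => sq_nonneg (v j))
      (Finset.mem_univ i)
  have hn0 : ∀ {m : ℕ} (v : Fin m → ℝ), 0 ≤ norm2 v := fun v => Real.sqrt_nonneg _
  have hMu0 : 0 ≤ Mu := by
    have := hMu 0 le_rfl
    have := hn0 (x 0); have := abs_nonneg (u 0); linarith
  have hMw0 : 0 ≤ Mw := by
    have := hMw 0 le_rfl
    have := hn0 (w 0); have := hn0 (deriv w 0); linarith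
  have hcpt : IsCompact (Metric.closedBall (0 : (Fin n → ℝ) × (Fin nd → ℝ)) (max Mu Mw)) :=
    isCompact_closedBall _ _
  obtain ⟨B, hB⟩ := hcpt.exists_bound_of_continuousOn hχ.continuousOn
  have hB' : ∀ t, 0 ≤ t → χ (x t, w t) ≤ B := by
    intro t ht
    refine (le_abs_self _).trans (hB _ ?_)
    rw [mem_closedBall_zero_iff, Prod.norm_def]
    have h1 := hMu t ht
    have h2 := hMw t ht
    have h3 := hn2 (x t)
    have h4 := hn2 (w t)
    have := abs_nonneg (u t)
    have := hn0 (deriv w t)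
    exact max_le_max (by simp only; linarith) (by simp only; linarith)
  let x' : ℝ → Fin n → ℝ := fun t i =>
    if h : (i : ℕ) + 1 < n then x t ⟨(i : ℕ) + 1, h⟩ else F (t, x t, w t) + b * u t
  have hB0 : 0 ≤ B := by
    have := hB' 0 le_rfl
    have := (hFbd 0 (x 0) (w 0)).1
    have := abs_nonneg (F (0, x 0, w 0))
    linarith
  set R : ℝ := 1 + (Mu + (B + |b| * Mu)) + Mw with hR
  have hbM : 0 ≤ |b| * Mu := by positivity
  refine ⟨B * R, fun t => fderiv ℝ F (t, x t, w t) (1, x' t, deriv w t), fun t ht => ⟨?_, ?_⟩⟩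
  · have h1 : HasDerivAt x (x' t) t := hasDerivAt_pi.2 (hx t ht)
    have h2 : HasDerivAt w (deriv w t) t :=
      (hw.differentiable (by norm_num) t).hasDerivAt
    have h3 : HasDerivAt (fun s => (s, x s, w s)) (1, x' t, deriv w t) t :=
      (hasDerivAt_id' t).prodMk (h1.prodMk h2)
    have h4 := (hF.differentiable (by norm_num) (t, x t, w t)).hasFDerivAt
    exact h4.comp_hasDerivAt t h3
  · have h1 := (fderiv ℝ F (t, x t, w t)).le_opNorm (1, x' t, deriv w t)
    rw [Real.norm_eq_abs] at h1
    refine h1.trans ?_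
    have hu := hMu t ht
    have hwt := hMw t ht
    have := hn0 (x t)
    have := hn0 (w t)
    have := abs_nonneg (u t)
    have hxb : ‖x' t‖ ≤ Mu + (B + |b| * Mu) := by
      rw [pi_norm_le_iff_of_nonneg (by positivity)]
      intro i
      rw [Real.norm_eq_abs]
      by_cases h : (i : ℕ) + 1 < n
      · simp only [x', h, dif_pos]
        have := norm_le_pi_norm (x t) ⟨(i : ℕ) + 1, h⟩
        rw [Real.norm_eq_abs] at this
        have := hn2 (x t)
        linarith
      · simp only [x', h, dif_neg, not_false_eq_true]
        have h2 := abs_add_le (F (t, x t, w t)) (b * u t)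
        rw [abs_mul] at h2
        have h3 := (hFbd t (x t) (w t)).1
        have h4 := hB' t ht
        have h5 : |b| * |u t| ≤ |b| * Mu :=
          mul_le_mul_of_nonneg_left (by linarith) (abs_nonneg b)
        linarith
    apply mul_le_mul ((hFbd t (x t) (w t)).2.trans (hB' t ht)) _ (norm_nonneg _) hB0
    rw [Prod.norm_def, Prod.norm_def]
    have := hn2 (deriv w t)
    apply max_le
    · simp only [norm_one]; linarith
    · apply max_le
      · simp only; linarith
      · simp only; linarith

theorem aux_Vderiv {I : Type*} [Fintype I] (P : Matrix I I ℝ) (η : ℝ → I → ℝ) (η' : I → ℝ) (t : ℝ)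
    (h : ∀ i, HasDerivAt (fun s => η s i) (η' i) t) :
    HasDerivAt (fun s => η s ⬝ᵥ P.mulVec (η s))
      (η' ⬝ᵥ P.mulVec (η t) + η t ⬝ᵥ P.mulVec η') t := by
  unfold Matrix.mulVec dotProduct
  rw [← Finset.sum_add_distrib]
  apply HasDerivAt.fun_sum
  intro i _
  apply (h i).fun_mul
  apply HasDerivAt.fun_sum
  intro j _
  exact (h j).const_mul _

theorem aux_shift_lt {n : ℕ} (η : Fin (n + 1) → ℝ) (i : Fin (n + 1)) (h : (i : ℕ) < n) :
    (shiftMat n).mulVec η i = η ⟨(i : ℕ) + 1, Nat.succ_lt_succ h⟩ := by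
  unfold Matrix.mulVec dotProduct
  rw [Finset.sum_eq_single (⟨(i : ℕ) + 1, Nat.succ_lt_succ h⟩ : Fin (n + 1))]
  · simp [shiftMat]
  · intro j _ hj
    have : ¬ ((i : ℕ) + 1 = j) := fun h => hj (Fin.ext h.symm)
    simp [shiftMat, this]
  · simp

theorem aux_shift_last {n : ℕ} (η : Fin (n + 1) → ℝ) (i : Fin (n + 1)) (h : ¬ (i : ℕ) < n) :
    (shiftMat n).mulVec η i = 0 := by
  unfold Matrix.mulVec dotProduct
  apply Finset.sum_eq_zero
  intro j _
  have : ¬ ((i : ℕ) + 1 = j) := by omega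
  simp [shiftMat, this]

theorem aux_core {n : ℕ} (p : Fin (n + 1) → ℝ → ℝ)
    (P : Matrix (Fin (n + 1)) (Fin (n + 1)) ℝ) (hP : P.PosDef) (c : ℝ) (hc : 0 < c)
    (hq : ∀ η : Fin (n + 1) → ℝ,
      η ⬝ᵥ ((shiftMat n)ᵀ * P + P * shiftMat n).mulVec η
        - η ⬝ᵥ P.mulVec (fun i => p i (η 0))
        - (fun i => p i (η 0)) ⬝ᵥ P.mulVec η ≤ - c * (η ⬝ᵥ η))
    (K : ℝ) (E0 : Fin (n + 1) → ℝ) (T : ℝ) (hT : 0 < T) :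
    ∃ K' : ℝ, 0 ≤ K' ∧ ∀ ε : ℝ, 0 < ε → ε ≤ 1 → ∀ (e : ℝ → Fin (n + 1) → ℝ) (D : ℝ → ℝ),
      e 0 = E0 → (∀ t, 0 ≤ t → |D t| ≤ K) →
      (∀ t, 0 ≤ t → ∀ i : Fin (n + 1), HasDerivAt (fun s => e s i)
        (if h : (i : ℕ) < n then e t ⟨(i : ℕ) + 1, Nat.succ_lt_succ h⟩
            - ε ^ (n - 1 - (i : ℕ)) * p i (e t 0 / ε ^ n)
          else D t - ε⁻¹ * p i (e t 0 / ε ^ n)) t) →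
      ∀ t, T ≤ t → ∑ i : Fin n, e t i.castSucc ^ 2 ≤ ε ^ 2 * K' := by
  obtain ⟨C1, -, hC1⟩ := aux_quad P
  obtain ⟨C2, hC2, hp0⟩ := aux_quad (-P)
  have hneg : Matrix.NegDef (-P) := by
    intro v hv
    have := hP.dotProduct_mulVec_pos hv
    simp only [star_trivial] at this
    simpa [Matrix.neg_mulVec] using this
  have hC2' := hC2 hneg
  set p0 : ℝ := -C2 with hp0def
  have hp0pos : 0 < p0 := by linarith
  have hlow : ∀ v : Fin (n + 1) → ℝ, p0 * (v ⬝ᵥ v) ≤ v ⬝ᵥ P.mulVec v := by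
    intro v
    have := hp0 v
    rw [Matrix.neg_mulVec, dotProduct_neg] at this
    linarith
  have hNN : ∀ v : Fin (n + 1) → ℝ, 0 ≤ v ⬝ᵥ v := fun v =>
    Finset.sum_nonneg fun i _ => mul_self_nonneg (v i)
  set CV : ℝ := |C1| + 1 with hCV
  have hCVpos : 0 < CV := by positivity
  have hup : ∀ v : Fin (n + 1) → ℝ, v ⬝ᵥ P.mulVec v ≤ CV * (v ⬝ᵥ v) := by
    intro v
    refine (hC1 v).trans (mul_le_mul_of_nonneg_right ?_ (hNN v))
    have := le_abs_self C1
    linarith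
  set q : ℝ := (∑ j, P (Fin.last n) j ^ 2) + 1 with hqdef
  have hqpos : 0 < q := by positivity
  have hv2 : ∀ v : Fin (n + 1) → ℝ, (P.mulVec v (Fin.last n)) ^ 2 ≤ q * (v ⬝ᵥ v) := by
    intro v
    have h1 := Finset.sum_mul_sq_le_sq_mul_sq Finset.univ (P (Fin.last n)) v
    have h2 : v ⬝ᵥ v = ∑ j, v j ^ 2 := by
      unfold dotProduct; exact Finset.sum_congr rfl fun j _ => (sq (v j)).symm
    have h3 : (P.mulVec v (Fin.last n)) = ∑ j, P (Fin.last n) j * v j := rfl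
    have h4 := hNN v
    rw [h3, hqdef]
    rw [h2] at h4 ⊢
    linarith
  set B : ℝ := 2 * q / c * K ^ 2 with hB
  have hB0 : 0 ≤ B := by positivity
  set a : ℝ := c / (2 * CV) with ha
  have hapos : 0 < a := by positivity
  set N0 : ℝ := E0 ⬝ᵥ E0 with hN0
  have hN00 : 0 ≤ N0 := hNN _
  set G : ℝ := ((2 * n).factorial : ℝ) / (a * T) ^ (2 * n) with hG
  have hG0 : 0 ≤ G := by positivity
  refine ⟨(G * (CV * N0) + B / a) / p0, by positivity, ?_⟩
  intro ε hε hε1 e D he0 hD hde t ht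
  set η : ℝ → Fin (n + 1) → ℝ := fun s i => e s i / ε ^ (n - (i : ℕ)) with hη
  have hη0 : ∀ s, η s 0 = e s 0 / ε ^ n := fun s => by simp [hη]
  set pv : ℝ → Fin (n + 1) → ℝ := fun s i => p i (η s 0) with hpv
  set η' : ℝ → Fin (n + 1) → ℝ := fun s =>
    ε⁻¹ • ((shiftMat n).mulVec (η s) - pv s) + D s • (Pi.single (Fin.last n) 1 : Fin (n + 1) → ℝ)
    with hη'
  have hηd : ∀ s, 0 ≤ s → ∀ i, HasDerivAt (fun r => η r i) (η' s i) s := by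
    intro s hs i
    have h1 := (hde s hs i).div_const (ε ^ (n - (i : ℕ)))
    refine h1.congr_deriv ?_
    simp only [hη', Pi.add_apply, Pi.smul_apply, Pi.sub_apply, smul_eq_mul, hpv, hη0]
    by_cases h : (i : ℕ) < n
    · rw [dif_pos h, aux_shift_lt _ _ h]
      have hne : i ≠ Fin.last n := fun hh => by rw [hh] at h; simp at h
      rw [Pi.single_eq_of_ne hne]
      have h2 : ε ^ (n - (i : ℕ)) = ε * ε ^ (n - 1 - (i : ℕ)) := by
        rw [← pow_succ']; congr 1; omega
      have h3 : n - ((i : ℕ) + 1) = n - 1 - (i : ℕ) := by omega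
      simp only [hη, h2, h3]
      have : ε ^ (n - 1 - (i : ℕ)) ≠ 0 := by positivity
      field_simp
      simp
    · rw [dif_neg h, aux_shift_last _ _ h]
      have hi : i = Fin.last n := Fin.ext (by have := i.2; simp; omega)
      subst hi
      simp
      ring
  have hsymm : Pᵀ = P := by
    have := hP.isHermitian
    rw [Matrix.IsHermitian, Matrix.conjTranspose_eq_transpose_of_trivial] at this
    exact this
  set V : ℝ → ℝ := fun s => η s ⬝ᵥ P.mulVec (η s) with hV
  set V' : ℝ → ℝ := fun s => η' s ⬝ᵥ P.mulVec (η s) + η s ⬝ᵥ P.mulVec (η' s) with hV'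
  have hVd : ∀ s, 0 ≤ s → HasDerivAt V (V' s) s := fun s hs =>
    aux_Vderiv P η (η' s) s (hηd s hs)
  have hVle : ∀ s, 0 ≤ s → V' s ≤ -(a / ε) * V s + B * ε := by
    intro s hs
    have hl : η s ⬝ᵥ P.mulVec (Pi.single (Fin.last n) 1 : Fin (n + 1) → ℝ)
        = P.mulVec (η s) (Fin.last n) := by
      conv_lhs => rw [← hsymm]
      rw [aux_tr]; simp
    have e1 : V' s = ε⁻¹ * (η s ⬝ᵥ ((shiftMat n)ᵀ * P + P * shiftMat n).mulVec (η s)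
        - η s ⬝ᵥ P.mulVec (pv s) - pv s ⬝ᵥ P.mulVec (η s))
        + 2 * (D s * P.mulVec (η s) (Fin.last n)) := by
      simp only [hV', hη', Matrix.mulVec_add, Matrix.mulVec_smul, Matrix.mulVec_sub,
        Matrix.add_mulVec, dotProduct_add, add_dotProduct, dotProduct_smul, smul_dotProduct,
        dotProduct_sub, sub_dotProduct, smul_eq_mul, ← Matrix.mulVec_mulVec, aux_tr, hl,
        single_one_dotProduct]
      ring
    have h1 := hq (η s)
    have h2 : ε⁻¹ * (η s ⬝ᵥ ((shiftMat n)ᵀ * P + P * shiftMat n).mulVec (η s)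
        - η s ⬝ᵥ P.mulVec (pv s) - pv s ⬝ᵥ P.mulVec (η s)) ≤ ε⁻¹ * (-c * (η s ⬝ᵥ η s)) :=
      mul_le_mul_of_nonneg_left h1 (by positivity)
    set z := P.mulVec (η s) (Fin.last n) with hz
    set N := η s ⬝ᵥ η s with hN
    have hzN : z ^ 2 ≤ q * N := hv2 (η s)
    set r : ℝ := c / (2 * ε * q) with hr
    have hr0 : 0 < r := by positivity
    have hDK : D s ^ 2 ≤ K ^ 2 := by
      rw [← sq_abs]; exact pow_le_pow_left₀ (abs_nonneg _) (hD s hs) 2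
    have h3 : 2 * (D s * z) ≤ r * z ^ 2 + r⁻¹ * D s ^ 2 := by
      have h := mul_nonneg hr0.le (sq_nonneg (z - r⁻¹ * D s))
      have h' : r * (z - r⁻¹ * D s) ^ 2 = r * z ^ 2 + r⁻¹ * D s ^ 2 - 2 * (D s * z) := by
        field_simp
        ring
      linarith
    have h4 : r * z ^ 2 ≤ c / (2 * ε) * N := by
      have := mul_le_mul_of_nonneg_left hzN hr0.le
      have h' : r * (q * N) = c / (2 * ε) * N := by
        rw [hr]; field_simp
      linarith
    have h5 : r⁻¹ * D s ^ 2 ≤ B * ε := by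
      have := mul_le_mul_of_nonneg_left hDK (inv_pos.2 hr0).le
      have h' : r⁻¹ * K ^ 2 = B * ε := by
        rw [hr, hB]; field_simp
      linarith
    have h6 : a / ε * V s ≤ c / (2 * ε) * N := by
      have := mul_le_mul_of_nonneg_left (hup (η s)) (by positivity : 0 ≤ a / ε)
      have h' : a / ε * (CV * N) = c / (2 * ε) * N := by
        rw [ha]; field_simp
      linarith
    have h7 : ε⁻¹ * (-c * N) = - (c / (2 * ε) * N) - c / (2 * ε) * N := by
      field_simp; ring
    rw [e1]
    linarith
  have ht0 : 0 ≤ t := hT.le.trans ht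
  have hg := aux_gronwall V V' (a / ε) (B * ε) (by positivity) (by positivity) hVd hVle t ht0
  have hV0 : V 0 ≤ CV * N0 * (1 / ε) ^ (2 * n) := by
    refine (hup (η 0)).trans ?_
    rw [mul_assoc]
    apply mul_le_mul_of_nonneg_left _ hCVpos.le
    rw [hN0]
    unfold dotProduct
    rw [Finset.sum_mul]
    apply Finset.sum_le_sum
    intro i _
    simp only [hη, he0]
    have hpw : ε ^ n ≤ ε ^ (n - (i : ℕ)) := pow_le_pow_of_le_one hε.le hε1 (by omega)
    have hpp : 0 < ε ^ n := by positivity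
    have hpp' : 0 < ε ^ (n - (i : ℕ)) := by positivity
    have h1 : (1 / ε ^ (n - (i : ℕ))) ≤ 1 / ε ^ n := one_div_le_one_div_of_le hpp hpw
    have h2 : (1 / ε ^ (n - (i : ℕ))) ^ 2 ≤ (1 / ε ^ n) ^ 2 :=
      pow_le_pow_left₀ (by positivity) h1 2
    have h3 : (1 / ε) ^ (2 * n) = (1 / ε ^ n) ^ 2 := by
      rw [mul_comm, pow_mul, _root_.one_div_pow]
    rw [h3]
    calc E0 i / ε ^ (n - (i : ℕ)) * (E0 i / ε ^ (n - (i : ℕ)))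
        = E0 i * E0 i * (1 / ε ^ (n - (i : ℕ))) ^ 2 := by ring
      _ ≤ _ := mul_le_mul_of_nonneg_left h2 (mul_self_nonneg _)
  have hexp : Real.exp (-(a / ε * t)) * (1 / ε) ^ (2 * n) ≤ G := by
    have h1 : Real.exp (-(a / ε * t)) ≤ Real.exp (-(a * T * (1 / ε))) := by
      apply Real.exp_le_exp.2
      have : a / ε * T ≤ a / ε * t := mul_le_mul_of_nonneg_left ht (by positivity)
      have h' : a * T * (1 / ε) = a / ε * T := by ring
      linarith
    have h2 := Real.pow_div_factorial_le_exp (x := a * T * (1 / ε)) (by positivity) (2 * n)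
    have h3 : Real.exp (-(a * T * (1 / ε))) * Real.exp (a * T * (1 / ε)) = 1 := by
      rw [← Real.exp_add]; simp
    have h4 := mul_le_mul_of_nonneg_left h2 (Real.exp_pos (-(a * T * (1 / ε)))).le
    rw [h3, mul_pow] at h4
    have hf : (0 : ℝ) < ((2 * n).factorial : ℝ) := by positivity
    have haT : 0 < (a * T) ^ (2 * n) := by positivity
    rw [hG, le_div_iff₀ haT]
    have h5 : Real.exp (-(a * T * (1 / ε))) * ((a * T) ^ (2 * n) * (1 / ε) ^ (2 * n))
        ≤ ((2 * n).factorial : ℝ) := by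
      rw [← mul_div_assoc, div_le_one hf] at h4
      exact h4
    have h6 : 0 ≤ (a * T) ^ (2 * n) * (1 / ε) ^ (2 * n) := by positivity
    have h7 := mul_le_mul_of_nonneg_right h1 h6
    linarith
  have hVt : V t ≤ G * (CV * N0) + B / a := by
    have h1 := mul_le_mul_of_nonneg_left hV0 (Real.exp_pos (-(a / ε * t))).le
    have h2 := mul_le_mul_of_nonneg_right hexp (by positivity : 0 ≤ CV * N0)
    have h3 : B * ε / (a / ε) = B / a * ε ^ 2 := by field_simp
    have h4 : B / a * ε ^ 2 ≤ B / a * 1 :=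
      mul_le_mul_of_nonneg_left (pow_le_one₀ hε.le hε1) (by positivity)
    rw [h3] at hg
    linarith
  have hNt : η t ⬝ᵥ η t ≤ (G * (CV * N0) + B / a) / p0 := by
    rw [le_div_iff₀ hp0pos]
    have := hlow (η t)
    linarith
  refine le_trans ?_ (mul_le_mul_of_nonneg_left hNt (by positivity))
  have h1 : ∑ i : Fin n, η t i.castSucc * η t i.castSucc ≤ η t ⬝ᵥ η t := by
    unfold dotProduct
    rw [Fin.sum_univ_castSucc]
    have := mul_self_nonneg (η t (Fin.last n))
    linarith
  refine le_trans ?_ (mul_le_mul_of_nonneg_left h1 (by positivity))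
  rw [Finset.mul_sum]
  apply Finset.sum_le_sum
  intro i _
  have h2 : e t i.castSucc = ε ^ (n - (i : ℕ)) * η t i.castSucc := by
    simp only [hη, Fin.val_castSucc]
    have : ε ^ (n - (i : ℕ)) ≠ 0 := by positivity
    field_simp
  rw [h2]
  have h3 : ε ^ (n - (i : ℕ)) ≤ ε := by
    have := i.2
    calc ε ^ (n - (i : ℕ)) ≤ ε ^ 1 := pow_le_pow_of_le_one hε.le hε1 (by omega)
      _ = ε := pow_one ε
  have h4 : (ε ^ (n - (i : ℕ))) ^ 2 ≤ ε ^ 2 := pow_le_pow_left₀ (by positivity) h3 2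
  calc (ε ^ (n - (i : ℕ)) * η t i.castSucc) ^ 2
      = (ε ^ (n - (i : ℕ))) ^ 2 * (η t i.castSucc * η t i.castSucc) := by ring
    _ ≤ _ := mul_le_mul_of_nonneg_right h4 (mul_self_nonneg _)

/-- Theorem 3 (i): neural observability of the integrator chain.  Under the boundedness
assumptions on the uncertainty `F`, the disturbance `w`, the control `u` and the state `x`,
if the LMI built from the `n+1` stacked scalar networks (with `T_k¹ = c̃`, `T_k² = 1`) has a
symmetric positive definite solution `P`, then for every `T > 0` the estimation error of the
first `n` states is uniformly small on `[T, ∞)` as `ε → 0⁺`. -/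
theorem integrator_chain_neural_observable
    {n nd : ℕ} (hn : 1 ≤ n) (b : ℝ)
    {σ : ℝ → ℝ} (hσ0 : σ 0 = 0)
    (F : ℝ × (Fin n → ℝ) × (Fin nd → ℝ) → ℝ) (hF : ContDiff ℝ 1 F)
    (χ : (Fin n → ℝ) × (Fin nd → ℝ) → ℝ) (hχ : Continuous χ)
    (hFbd : ∀ (t : ℝ) (xv : Fin n → ℝ) (wv : Fin nd → ℝ),
      |F (t, xv, wv)| ≤ χ (xv, wv) ∧ ‖fderiv ℝ F (t, xv, wv)‖ ≤ χ (xv, wv))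
    (w : ℝ → Fin nd → ℝ) (hw : ContDiff ℝ 1 w)
    (Mw : ℝ) (hMw : ∀ t : ℝ, 0 ≤ t → norm2 (w t) + norm2 (deriv w t) ≤ Mw)
    (u : ℝ → ℝ) (x : ℝ → Fin n → ℝ)
    (hx : ∀ t : ℝ, 0 ≤ t → ∀ i : Fin n, HasDerivAt (fun s => x s i)
      (if h : (i : ℕ) + 1 < n then x t ⟨(i : ℕ) + 1, h⟩ else F (t, x t, w t) + b * u t) t)
    (Mu : ℝ) (hMu : ∀ t : ℝ, 0 ≤ t → norm2 (x t) + |u t| ≤ Mu)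
    (nets : Fin (n + 1) → ResNet 1 1)
    (α β lam : (Σ k, (nets k).NIdx) → ℝ)
    (hαβ : ∀ i, α i ≤ β i) (hsec : ∀ i, SectorBounded σ (α i) (β i))
    (hlam : ∀ i, 0 ≤ lam i)
    (P : Matrix (Fin (n + 1)) (Fin (n + 1)) ℝ) (hP : P.PosDef)
    (hLMI : Matrix.NegDef
      ((RpiS nets (ctilde n))ᵀ
          * Matrix.fromBlocks ((shiftMat n)ᵀ * P + P * shiftMat n) (-P) (-P) 0
          * RpiS nets (ctilde n)
        + (RxiS nets (ctilde n))ᵀ * (Psi α β)ᵀ * Mmat lam * Psi α β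
          * RxiS nets (ctilde n)))
    (xh0 : Fin (n + 1) → ℝ) :
    ∀ T δ : ℝ, 0 < T → 0 < δ → ∃ ε₀ : ℝ, 0 < ε₀ ∧
      ∀ ε : ℝ, 0 < ε → ε < ε₀ →
        ∀ xh : ℝ → Fin (n + 1) → ℝ, xh 0 = xh0 →
          (∀ t : ℝ, 0 ≤ t → ∀ i : Fin (n + 1), HasDerivAt (fun s => xh s i)
            (if _ : (i : ℕ) < n then
              xh t ⟨(i : ℕ) + 1, by omega⟩
                + ε ^ (n - 1 - (i : ℕ))
                  * ((nets i).apply σ (fun _ => (x t ⟨0, hn⟩ - xh t 0) / ε ^ n) 0)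
                + (if (i : ℕ) = n - 1 then b * u t else 0)
            else
              ε⁻¹ * ((nets i).apply σ (fun _ => (x t ⟨0, hn⟩ - xh t 0) / ε ^ n) 0)) t) →
          ∀ t : ℝ, T ≤ t →
            norm2 (fun i : Fin n => x t i - xh t i.castSucc) ≤ δ := by
  intro T δ hT hδ
  obtain ⟨K, D, hD⟩ := aux_Fdot b F hF χ hχ hFbd w hw Mw hMw u x hx Mu hMu
  obtain ⟨c, hc, hq⟩ := aux_LMI nets α β lam hsec hlam P hLMI
  obtain ⟨K', hK', hcore⟩ := aux_core (fun i s => (nets i).apply σ (fun _ => s) 0) P hP c hc hq K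
    (fun i => (if h : (i : ℕ) < n then x 0 ⟨i, h⟩ else F (0, x 0, w 0)) - xh0 i) T hT
  refine ⟨min 1 (δ / Real.sqrt (K' + 1)), ?_, ?_⟩
  · have : 0 < Real.sqrt (K' + 1) := Real.sqrt_pos.2 (by linarith)
    exact lt_min one_pos (by positivity)
  intro ε hε hε0 xh hxh0 hxh t ht
  have h1 : ε ≤ 1 := (hε0.trans_le (min_le_left _ _)).le
  have h2 : ε < δ / Real.sqrt (K' + 1) := hε0.trans_le (min_le_right _ _)
  have hsq : 0 < Real.sqrt (K' + 1) := Real.sqrt_pos.2 (by linarith)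
  have key := hcore ε hε h1
    (fun s i => (if h : (i : ℕ) < n then x s ⟨i, h⟩ else F (s, x s, w s)) - xh s i) D
    (by rw [hxh0]) (fun s hs => (hD s hs).2) ?_ t ht
  · unfold norm2
    apply Real.sqrt_le_iff.2 ⟨hδ.le, ?_⟩
    have h3 : ∑ i : Fin n, (x t i - xh t i.castSucc) ^ 2 ≤ ε ^ 2 * K' := by
      simpa using key
    rw [lt_div_iff₀ hsq] at h2
    have h4 : (ε * Real.sqrt (K' + 1)) ^ 2 ≤ δ ^ 2 :=
      pow_le_pow_left₀ (by positivity) h2.le 2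
    rw [mul_pow, Real.sq_sqrt (by linarith)] at h4
    have := sq_nonneg ε
    linarith
  · intro s hs i
    have hz : (if h : ((0 : Fin (n + 1)) : ℕ) < n then x s ⟨((0 : Fin (n + 1)) : ℕ), h⟩
        else F (s, x s, w s)) = x s ⟨0, hn⟩ := by
      rw [dif_pos (show ((0 : Fin (n + 1)) : ℕ) < n from hn)]
      rfl
    simp only [hz]
    have hxi := hxh s hs i
    by_cases h : (i : ℕ) < n
    · simp only [h, dif_pos] at hxi ⊢
      refine ((hx s hs ⟨i, h⟩).fun_sub hxi).congr_deriv ?_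
      by_cases h' : (i : ℕ) + 1 < n
      · have h'' : ¬ ((i : ℕ) = n - 1) := by omega
        simp only [h', h'', dif_pos, if_false]
        ring
      · have h'' : (i : ℕ) = n - 1 := by omega
        rw [if_pos h'', dif_neg h', dif_neg h']
        ring
    · simp only [h, dif_neg, not_false_eq_true] at hxi ⊢
      exact ((hD s hs).1).fun_sub hxi
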